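/- arXiv:2511.06589 — 6 statements merged into one kernel-verified Lean document; each statement's English description precedes it below -/
import Mathlib

section
/- Let n ∈ ℕ, 1 ≤ p < ∞, p < r < ∞, and let q satisfy r < q < ∞. If f is a measurable function on ℝ^n with ‖f‖_{L^{p,r}} < ∞ and ‖f‖_{L^∞} < ∞, then f ∈ L^q(ℝ^n) and ‖f‖_{L^q} ≤ 2 · (‖f‖_{L^{p,r}})^{p/q} · (‖f‖_{L^∞})^{1−p/q}. -/
open MeasureTheory ENNReal

noncomputable section

variable {n : ℕ}

/-- ℝ^n as Euclidean space with Lebesgue measure. -/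
abbrev En (n : ℕ) : Type := EuclideanSpace ℝ (Fin n)

/-- Distribution function d_f(λ) = m({x : |f x| > λ}). -/
def distFn (f : En n → ℝ) (l : ℝ) : ℝ≥0∞ := volume {x | l < |f x|}

/-- Non-increasing rearrangement f*(t) = inf {λ > 0 : d_f(λ) ≤ t}. -/
def rearr (f : En n → ℝ) (t : ℝ) : ℝ≥0∞ :=
  sInf (ENNReal.ofReal '' {l : ℝ | 0 < l ∧ distFn f l ≤ ENNReal.ofReal t})

/-- Lorentz quasi-norm ‖f‖_{L^{p,r}}; the second index r lives in ℝ≥0∞. -/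
def lorentzNorm (f : En n → ℝ) (p : ℝ) (r : ℝ≥0∞) : ℝ≥0∞ :=
  if r = ∞ then ⨆ (s : ℝ) (_ : 0 < s), ENNReal.ofReal (s ^ (1 / p)) * rearr f s
  else (∫⁻ s in Set.Ioi (0 : ℝ),
      (ENNReal.ofReal (s ^ (1 / p)) * rearr f s) ^ r.toReal / ENNReal.ofReal s) ^ (1 / r.toReal)

/-- The L^q norm, 1 ≤ q < ∞. -/
def lqNorm (f : En n → ℝ) (q : ℝ) : ℝ≥0∞ :=
  (∫⁻ x, ENNReal.ofReal |f x| ^ q) ^ (1 / q)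

/-- The L^∞ norm (essential supremum of |f|). -/
def linftyNorm (f : En n → ℝ) : ℝ≥0∞ :=
  essSup (fun x => ENNReal.ofReal |f x|) volume

/-- Average of f over the ball B(c, ρ). -/
def ballAvg (f : En n → ℝ) (c : En n) (ρ : ℝ) : ℝ := ⨍ y in Metric.ball c ρ, f y

/-- The BMO seminorm: sup over balls of (1/m(B)) ∫_B |f - f_B|. -/
def bmoNorm (f : En n → ℝ) : ℝ≥0∞ :=
  ⨆ (c : En n) (ρ : ℝ) (_ : 0 < ρ),
    (volume (Metric.ball c ρ))⁻¹ *
      ∫⁻ x in Metric.ball c ρ, ENNReal.ofReal |f x - ballAvg f c ρ|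

/-- The Morrey norm ‖f‖_{M^{p;κ}} = sup_B m(B)^{-κ/p} (∫_B |f|^p)^{1/p}. -/
def morreyNorm (f : En n → ℝ) (p κ : ℝ) : ℝ≥0∞ :=
  ⨆ (c : En n) (ρ : ℝ) (_ : 0 < ρ),
    volume (Metric.ball c ρ) ^ (-(κ / p)) *
      (∫⁻ x in Metric.ball c ρ, ENNReal.ofReal |f x| ^ p) ^ (1 / p)

/-- The weak Morrey norm ‖f‖_{WM^{p;κ}}. -/
def wMorreyNorm (f : En n → ℝ) (p κ : ℝ) : ℝ≥0∞ :=
  ⨆ (c : En n) (ρ : ℝ) (_ : 0 < ρ),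
    volume (Metric.ball c ρ) ^ (-(κ / p)) *
      ⨆ (l : ℝ) (_ : 0 < l),
        ENNReal.ofReal l * volume {x ∈ Metric.ball c ρ | l < |f x|} ^ (1 / p)

/-- The Lorentz–Morrey quasi-norm ‖f‖_{LM^{p,r;κ}} = sup_B m(B)^{-κ/p} ‖f·1_B‖_{L^{p,r}}. -/
def lmNorm (f : En n → ℝ) (p : ℝ) (r : ℝ≥0∞) (κ : ℝ) : ℝ≥0∞ :=
  ⨆ (c : En n) (ρ : ℝ) (_ : 0 < ρ),
    volume (Metric.ball c ρ) ^ (-(κ / p)) *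
      lorentzNorm ((Metric.ball c ρ).indicator f) p r

/-- The averaged rearrangement f**(t) = (1/t) ∫₀^t f*(τ) dτ. -/
def doubleStar (f : En n → ℝ) (t : ℝ) : ℝ≥0∞ :=
  (ENNReal.ofReal t)⁻¹ * ∫⁻ τ in Set.Ioc (0 : ℝ) t, rearr f τ

/-- ‖f‖_𝒲 = sup_{t>0} (f**(t) - f*(t)). -/
def wNorm (f : En n → ℝ) : ℝ≥0∞ :=
  ⨆ (t : ℝ) (_ : 0 < t), (doubleStar f t - rearr f t)

/-- Φ_p(t) = exp t − Σ_{j<p} t^j/j!. -/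
def Phi (p : ℕ) (t : ℝ) : ℝ :=
  Real.exp t - ∑ j ∈ Finset.range p, t ^ j / (Nat.factorial j : ℝ)

theorem rearr_antitone (f : En n → ℝ) : Antitone (rearr f) := by
  intro s t hst
  refine sInf_le_sInf (Set.image_mono ?_)
  rintro l ⟨hl, h⟩
  exact ⟨hl, h.trans (ENNReal.ofReal_le_ofReal hst)⟩

theorem rearr_le_linftyNorm (f : En n → ℝ) (t : ℝ) : rearr f t ≤ linftyNorm f := by
  refine le_of_forall_gt_imp_ge_of_dense fun c hc => ?_
  obtain ⟨l, hl, hlc⟩ := ENNReal.lt_iff_exists_nnreal_btwn.1 hc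
  refine le_trans (sInf_le ⟨(l : ℝ), ⟨?_, ?_⟩, rfl⟩) (by simpa using hlc.le)
  · exact_mod_cast (zero_le.trans_lt hl)
  · have h : distFn f l = 0 := by
      have h_ae := ae_lt_of_essSup_lt (μ := volume) (f := fun x => ENNReal.ofReal |f x|) hl
      refine measure_mono_null (fun x hx => ?_) (ae_iff.1 h_ae)
      simp only [Set.mem_ofPred_eq, not_lt] at hx ⊢
      simpa using ENNReal.ofReal_le_ofReal hx.le
    simp [h]

theorem le_rearr_of_lt_distFn {f : En n → ℝ} {l t : ℝ}
    (h : ENNReal.ofReal t < distFn f l) : ENNReal.ofReal l ≤ rearr f t := by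
  refine le_sInf ?_
  rintro _ ⟨k, ⟨-, hk⟩, rfl⟩
  refine ENNReal.ofReal_le_ofReal (le_of_lt ?_)
  by_contra! hkl
  exact (h.trans_le ((measure_mono fun x hx => lt_of_le_of_lt hkl hx).trans hk)).false

theorem volume_restrict_setOf_ofReal_lt (d : ℝ≥0∞) :
    volume.restrict (Set.Ioi (0 : ℝ)) {t | ENNReal.ofReal t < d} = d := by
  rw [Measure.restrict_apply (measurableSet_lt ENNReal.measurable_ofReal measurable_const)]
  rcases eq_or_ne d ∞ with rfl | hd
  · simp
  · have : {t | ENNReal.ofReal t < d} ∩ Set.Ioi (0 : ℝ) = Set.Ioo 0 d.toReal := by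
      ext t
      simp only [Set.mem_inter_iff, Set.mem_ofPred_eq, Set.mem_Ioi, Set.mem_Ioo]
      rw [and_comm]
      exact and_congr_right fun ht => ENNReal.ofReal_lt_iff_lt_toReal ht.le hd
    simp [this, hd]

theorem lintegral_rpow_le_lintegral_rearr_rpow {f : En n → ℝ} (hf : Measurable f)
    (hLinf : linftyNorm f ≠ ∞) {r : ℝ} (hr : 0 < r) :
    ∫⁻ x, ENNReal.ofReal |f x| ^ r ≤ ∫⁻ t in Set.Ioi (0 : ℝ), rearr f t ^ r := by
  have h_fin (t : ℝ) : rearr f t ≠ ∞ := ne_top_of_le_ne_top hLinf (rearr_le_linftyNorm f t)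
  have h_left : ∫⁻ x, ENNReal.ofReal |f x| ^ r = ∫⁻ x, ENNReal.ofReal (|f x| ^ r) :=
    lintegral_congr fun x => ENNReal.ofReal_rpow_of_nonneg (abs_nonneg _) hr.le
  have h_right : ∫⁻ t in Set.Ioi (0 : ℝ), rearr f t ^ r =
      ∫⁻ t in Set.Ioi (0 : ℝ), ENNReal.ofReal ((rearr f t).toReal ^ r) :=
    lintegral_congr fun t => by
      rw [← ENNReal.ofReal_rpow_of_nonneg ENNReal.toReal_nonneg hr.le,
        ENNReal.ofReal_toReal (h_fin t)]
  rw [h_left, h_right,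
    lintegral_rpow_eq_lintegral_meas_lt_mul volume (ae_of_all _ fun x => abs_nonneg (f x))
      (by fun_prop) hr,
    lintegral_rpow_eq_lintegral_meas_le_mul _ (ae_of_all _ fun t => ENNReal.toReal_nonneg)
      (rearr_antitone f).measurable.ennreal_toReal.aemeasurable hr]
  gcongr with l
  change distFn f l ≤ _
  rw [← volume_restrict_setOf_ofReal_lt (distFn f l)]
  refine measure_mono fun t ht => ?_
  exact (ENNReal.ofReal_le_iff_le_toReal (h_fin t)).1 (le_rearr_of_lt_distFn ht)

theorem lintegral_rearr_rpow_le (f : En n → ℝ) {p r a : ℝ} (hp : 0 < p) (hpr : p ≤ r)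
    (ha : 0 < a) :
    ∫⁻ t in Set.Ioi (0 : ℝ), rearr f t ^ r ≤
      ENNReal.ofReal a * linftyNorm f ^ r + ENNReal.ofReal (a ^ (1 - r / p)) *
        lorentzNorm f p (ENNReal.ofReal r) ^ r := by
  have hr : 0 < r := hp.trans_le hpr
  have h_norm : lorentzNorm f p (ENNReal.ofReal r) ^ r = ∫⁻ s in Set.Ioi (0 : ℝ),
      (ENNReal.ofReal (s ^ (1 / p)) * rearr f s) ^ r / ENNReal.ofReal s := by
    rw [lorentzNorm, if_neg ENNReal.ofReal_ne_top, ENNReal.toReal_ofReal hr.le,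
      ← ENNReal.rpow_mul, one_div_mul_cancel hr.ne', ENNReal.rpow_one]
  rw [h_norm, ← Set.Ioc_union_Ioi_eq_Ioi ha.le]
  refine (lintegral_union_le _ _ _).trans (add_le_add ?_ ?_)
  · calc ∫⁻ t in Set.Ioc 0 a, rearr f t ^ r
        ≤ ∫⁻ _ in Set.Ioc 0 a, linftyNorm f ^ r :=
          lintegral_mono fun t => ENNReal.rpow_le_rpow (rearr_le_linftyNorm f t) hr.le
      _ = ENNReal.ofReal a * linftyNorm f ^ r := by simp [mul_comm]
  · rw [Set.Ioc_union_Ioi_eq_Ioi ha.le, ← lintegral_const_mul' _ _ ENNReal.ofReal_ne_top]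
    refine le_trans (setLIntegral_mono' measurableSet_Ioi fun s (hs : a < s) => ?_)
      (lintegral_mono_set (Set.Ioi_subset_Ioi ha.le))
    have hs0 : 0 < s := ha.trans hs
    have h_one : 1 ≤ a ^ (1 - r / p) * (s ^ (r / p) / s) := by
      have h_exp : 0 ≤ r / p - 1 := by rw [sub_nonneg, one_le_div hp]; exact hpr
      rw [← Real.rpow_sub_one hs0.ne', ← neg_sub, Real.rpow_neg ha.le, inv_mul_eq_div,
        one_le_div (by positivity)]
      exact Real.rpow_le_rpow ha.le hs.le h_exp
    calc rearr f s ^ r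
        ≤ ENNReal.ofReal (a ^ (1 - r / p) * (s ^ (r / p) / s)) * rearr f s ^ r :=
          le_mul_of_one_le_left zero_le (by simpa using ENNReal.ofReal_le_ofReal h_one)
      _ = _ := by
          rw [ENNReal.ofReal_mul (by positivity), ENNReal.ofReal_div_of_pos hs0,
            ENNReal.mul_rpow_of_nonneg _ _ hr.le,
            ENNReal.ofReal_rpow_of_nonneg (by positivity) hr.le, ← Real.rpow_mul hs0.le,
            one_div_mul_eq_div]
          simp only [div_eq_mul_inv]
          ring

theorem lintegral_rearr_rpow_le_lorentzNorm_mul (f : En n → ℝ) {p r : ℝ} (hp : 0 < p)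
    (hpr : p < r) (hLpr : lorentzNorm f p (ENNReal.ofReal r) ≠ ∞) (hLinf : linftyNorm f ≠ ∞) :
    ∫⁻ t in Set.Ioi (0 : ℝ), rearr f t ^ r ≤
      2 * lorentzNorm f p (ENNReal.ofReal r) ^ p * linftyNorm f ^ (r - p) := by
  have hr : 0 < r := hp.trans hpr
  have h_split (a : ℝ) (ha : 0 < a) := lintegral_rearr_rpow_le f hp hpr.le ha
  generalize hA : lorentzNorm f p (ENNReal.ofReal r) = A at *
  rcases eq_or_ne (linftyNorm f) 0 with hL | hL
  · have h_zero (t : ℝ) : rearr f t = 0 := by simpa [hL] using rearr_le_linftyNorm f t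
    simp [h_zero, hr]
  generalize linftyNorm f = L at *
  rcases eq_or_ne A 0 with rfl | hA0
  · simp only [ENNReal.zero_rpow_of_pos hr, mul_zero, add_zero] at h_split
    have h_lim : Filter.Tendsto (fun a : ℝ => ENNReal.ofReal a * L ^ r)
        (nhdsWithin 0 (Set.Ioi 0)) (nhds 0) := by
      have h := ENNReal.Tendsto.mul_const (b := L ^ r)
        ((ENNReal.continuous_ofReal.tendsto 0).mono_left
          (nhdsWithin_le_nhds (s := Set.Ioi (0 : ℝ))))
        (Or.inr (ENNReal.rpow_ne_top_of_nonneg hr.le hLinf))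
      simpa using h
    refine (ge_of_tendsto h_lim ?_).trans zero_le
    filter_upwards [self_mem_nhdsWithin] with a ha using h_split a ha
  · lift A to NNReal using hLpr
    lift L to NNReal using hLinf
    have hA' : (0 : ℝ) < A := by exact_mod_cast pos_iff_ne_zero.2 hA0
    have hL' : (0 : ℝ) < L := by exact_mod_cast pos_iff_ne_zero.2 hL
    refine (h_split (((A : ℝ) / L) ^ p) (by positivity)).trans (le_of_eq ?_)
    rw [← ENNReal.ofReal_coe_nnreal (p := A), ← ENNReal.ofReal_coe_nnreal (p := L)]
    simp only [ENNReal.ofReal_rpow_of_pos hA', ENNReal.ofReal_rpow_of_pos hL']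
    rw [← ENNReal.ofReal_mul (by positivity), ← ENNReal.ofReal_mul (by positivity),
      mul_assoc, ← ENNReal.ofReal_mul (by positivity), two_mul]
    have h_exp : p * (1 - r / p) = p - r := by field_simp
    rw [← Real.rpow_mul (by positivity), h_exp, Real.div_rpow hA'.le hL'.le,
      Real.div_rpow hA'.le hL'.le, Real.rpow_sub hA', Real.rpow_sub hL', Real.rpow_sub hL']
    congr 2 <;> field_simp

theorem lintegral_rpow_le_mul_linftyNorm_rpow (f : En n → ℝ) {r q : ℝ} (hr : 0 ≤ r)
    (hrq : r ≤ q) (hLinf : linftyNorm f ≠ ∞) :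
    ∫⁻ x, ENNReal.ofReal |f x| ^ q ≤
      (∫⁻ x, ENNReal.ofReal |f x| ^ r) * linftyNorm f ^ (q - r) := by
  rw [← lintegral_mul_const' _ _ (ENNReal.rpow_ne_top_of_nonneg (sub_nonneg.2 hrq) hLinf)]
  refine lintegral_mono_ae ?_
  filter_upwards [ENNReal.ae_le_essSup (μ := volume) fun x => ENNReal.ofReal |f x|] with x hx
  calc ENNReal.ofReal |f x| ^ q
      = ENNReal.ofReal |f x| ^ r * ENNReal.ofReal |f x| ^ (q - r) := by
        rw [← ENNReal.rpow_add_of_nonneg _ _ hr (sub_nonneg.2 hrq), add_sub_cancel]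
    _ ≤ _ := by
        gcongr
        exact hx

theorem stmt0 (n : ℕ) (p r q : ℝ) (hp : 1 ≤ p) (hpr : p < r) (hrq : r < q)
    (f : En n → ℝ) (hf : Measurable f)
    (hLpr : lorentzNorm f p (ENNReal.ofReal r) ≠ ∞)
    (hLinf : linftyNorm f ≠ ∞) :
    lqNorm f q ≠ ∞ ∧
      lqNorm f q ≤
        2 * lorentzNorm f p (ENNReal.ofReal r) ^ (p / q) * linftyNorm f ^ (1 - p / q) := by
  have hp0 : 0 < p := one_pos.trans_le hp
  have hr : 0 < r := hp0.trans hpr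
  have hq : 0 < q := hr.trans hrq
  have h_pq : p / q ≤ 1 := (div_le_one hq).2 (hpr.trans hrq).le
  have h_int : ∫⁻ x, ENNReal.ofReal |f x| ^ q ≤
      2 * lorentzNorm f p (ENNReal.ofReal r) ^ p * linftyNorm f ^ (q - p) :=
    calc ∫⁻ x, ENNReal.ofReal |f x| ^ q
        ≤ (∫⁻ x, ENNReal.ofReal |f x| ^ r) * linftyNorm f ^ (q - r) :=
          lintegral_rpow_le_mul_linftyNorm_rpow f hr.le hrq.le hLinf
      _ ≤ 2 * lorentzNorm f p (ENNReal.ofReal r) ^ p * linftyNorm f ^ (r - p) *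
            linftyNorm f ^ (q - r) := by
          gcongr
          exact (lintegral_rpow_le_lintegral_rearr_rpow hf hLinf hr).trans
            (lintegral_rearr_rpow_le_lorentzNorm_mul f hp0 hpr hLpr hLinf)
      _ = _ := by
          rw [mul_assoc, ← ENNReal.rpow_add_of_nonneg _ _ (sub_nonneg.2 hpr.le)
            (sub_nonneg.2 hrq.le), add_comm, sub_add_sub_cancel]
  have h_bound : lqNorm f q ≤
      2 * lorentzNorm f p (ENNReal.ofReal r) ^ (p / q) * linftyNorm f ^ (1 - p / q) := by
    have hq_inv : 0 ≤ 1 / q := by positivity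
    refine (ENNReal.rpow_le_rpow h_int hq_inv).trans ?_
    rw [ENNReal.mul_rpow_of_nonneg _ _ hq_inv, ENNReal.mul_rpow_of_nonneg _ _ hq_inv,
      ← ENNReal.rpow_mul, ← ENNReal.rpow_mul, mul_one_div, mul_one_div, sub_div,
      div_self hq.ne']
    gcongr
    refine (ENNReal.rpow_le_rpow_of_exponent_le one_le_two ?_).trans_eq (ENNReal.rpow_one 2)
    rw [div_le_one hq]
    linarith
  refine ⟨ne_top_of_le_ne_top ?_ h_bound, h_bound⟩
  exact ENNReal.mul_ne_top
    (ENNReal.mul_ne_top ENNReal.ofNat_ne_top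
      (ENNReal.rpow_ne_top_of_nonneg (by positivity) hLpr))
    (ENNReal.rpow_ne_top_of_nonneg (sub_nonneg.2 h_pq) hLinf)
end
end

section
/- Let n ∈ ℕ, 1 ≤ p < ∞, 0 < κ < 1, and let q satisfy p < q < ∞. If f is a measurable function on ℝ^n with ‖f‖_{LM^{p,∞;κ}} < ∞ and ‖f‖_{L^∞} < ∞, then f ∈ M^{q;κ}(ℝ^n) and ‖f‖_{M^{q;κ}} ≤ 2^{1−1/q} · (q/(q−p))^{1/q} · (‖f‖_{LM^{p,∞;κ}})^{p/q} · (‖f‖_{L^∞})^{1−p/q}. -/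
open MeasureTheory ENNReal

noncomputable section

variable {n : ℕ}

/-- A weak-type bound: the Lorentz `L^{p,∞}` quasi-norm controls the distribution function. -/
theorem distFn_le_lorentzNorm_top (g : En n → ℝ) {p : ℝ} (hp : 0 < p) {l : ℝ} (hl : 0 < l) :
    distFn g l ≤ lorentzNorm g p ∞ ^ p * ENNReal.ofReal (l ^ (-p)) := by
  refine le_of_forall_lt fun c hc => ?_
  obtain ⟨s, hcs, hsD⟩ := ENNReal.lt_iff_exists_nnreal_btwn.1 hc
  refine hcs.trans_le ?_
  have hs : (0 : ℝ) < s := by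
    have : (0 : ℝ≥0∞) < s := bot_le.trans_lt hcs
    exact_mod_cast this
  have hrearr : ENNReal.ofReal l ≤ rearr g s := by
    refine le_sInf ?_
    rintro _ ⟨m, ⟨-, hm⟩, rfl⟩
    refine ENNReal.ofReal_le_ofReal (le_of_not_gt fun hml => ?_)
    rw [ENNReal.ofReal_coe_nnreal] at hm
    have hanti : distFn g l ≤ distFn g m := measure_mono fun x hx => hml.trans hx
    exact absurd (hsD.trans_le (hanti.trans hm)) (lt_irrefl _)
  have hA : ENNReal.ofReal ((s : ℝ) ^ (1 / p)) * ENNReal.ofReal l ≤ lorentzNorm g p ∞ := by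
    rw [lorentzNorm, if_pos rfl]
    exact le_trans (by gcongr) (le_iSup₂ (f := fun (s : ℝ) (_ : 0 < s) =>
      ENNReal.ofReal (s ^ (1 / p)) * rearr g s) (s : ℝ) hs)
  calc (s : ℝ≥0∞)
      = (ENNReal.ofReal ((s : ℝ) ^ (1 / p)) * ENNReal.ofReal l) ^ p *
          ENNReal.ofReal (l ^ (-p)) := by
        rw [← ENNReal.ofReal_mul (by positivity), ENNReal.ofReal_rpow_of_nonneg (by positivity)
          hp.le, ← ENNReal.ofReal_mul (by positivity), Real.mul_rpow (by positivity) hl.le,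
          ← Real.rpow_mul hs.le, mul_assoc, ← Real.rpow_add hl, one_div_mul_cancel hp.ne',
          add_neg_cancel, Real.rpow_one, Real.rpow_zero, mul_one, ENNReal.ofReal_coe_nnreal]
    _ ≤ _ := by gcongr

theorem distFn_eq_zero_of_linftyNorm_le {f : En n → ℝ} {l : ℝ} (hl : 0 ≤ l)
    (h : linftyNorm f ≤ ENNReal.ofReal l) : distFn f l = 0 := by
  refine measure_mono_null (t := {x | ¬ ENNReal.ofReal |f x| ≤ linftyNorm f}) ?_
    (_root_.ae_le_essSup (μ := volume) (f := fun x => ENNReal.ofReal |f x|))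
  intro x hx hle
  have hx : l < |f x| := hx
  exact absurd (hle.trans h)
    (not_le.2 ((ENNReal.ofReal_lt_ofReal_iff_of_nonneg hl).2 hx))

theorem lintegral_Ioc_rpow {a M : ℝ} (ha : 0 < a) (hM : 0 ≤ M) :
    ∫⁻ t in Set.Ioc 0 M, ENNReal.ofReal (t ^ (a - 1)) = ENNReal.ofReal (M ^ a / a) := by
  rw [← ofReal_integral_eq_lintegral_ofReal, ← intervalIntegral.integral_of_le hM,
    integral_rpow (Or.inl (by linarith)), sub_add_cancel, Real.zero_rpow ha.ne', sub_zero]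
  · exact (intervalIntegrable_iff_integrableOn_Ioc_of_le hM).1
      (intervalIntegral.intervalIntegrable_rpow' (by linarith))
  · exact (ae_restrict_iff' measurableSet_Ioc).2
      (.of_forall fun t ht => Real.rpow_nonneg ht.1.le _)

/-- Interpolation between `L^{p,∞}` and `L^∞`. -/
theorem lintegral_rpow_le_lorentzNorm_top {g : En n → ℝ} (hg : Measurable g) {p q : ℝ}
    (hp : 0 < p) (hpq : p < q) (hM : linftyNorm g ≠ ∞) :
    ∫⁻ x, ENNReal.ofReal |g x| ^ q ≤
      ENNReal.ofReal (q / (q - p)) * lorentzNorm g p ∞ ^ p * linftyNorm g ^ (q - p) := by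
  have hq : 0 < q := hp.trans hpq
  have hqp : 0 < q - p := sub_pos.2 hpq
  obtain ⟨M, hM0, hMg⟩ : ∃ M : ℝ, 0 ≤ M ∧ linftyNorm g = ENNReal.ofReal M :=
    ⟨_, ENNReal.toReal_nonneg, (ENNReal.ofReal_toReal hM).symm⟩
  have hcake : ∫⁻ x, ENNReal.ofReal |g x| ^ q =
      ENNReal.ofReal q * ∫⁻ t in Set.Ioi 0, distFn g t * ENNReal.ofReal (t ^ (q - 1)) := by
    refine (lintegral_congr fun x =>
      ENNReal.ofReal_rpow_of_nonneg (abs_nonneg _) hq.le).trans ?_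
    exact lintegral_rpow_eq_lintegral_meas_lt_mul volume (f := fun x => |g x|)
      (.of_forall fun x => abs_nonneg _) (by fun_prop) hq
  have hbound : ∫⁻ t in Set.Ioi 0, distFn g t * ENNReal.ofReal (t ^ (q - 1)) ≤
      ∫⁻ t in Set.Ioc 0 M, lorentzNorm g p ∞ ^ p * ENNReal.ofReal (t ^ (q - p - 1)) := by
    rw [← lintegral_indicator measurableSet_Ioi, ← lintegral_indicator measurableSet_Ioc]
    refine lintegral_mono fun t => ?_
    by_cases ht : 0 < t
    · rw [Set.indicator_of_mem (Set.mem_Ioi.2 ht)]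
      by_cases htM : t ≤ M
      · rw [Set.indicator_of_mem (Set.mem_Ioc.2 ⟨ht, htM⟩)]
        refine (mul_le_mul_left (distFn_le_lorentzNorm_top g hp ht) _).trans_eq ?_
        rw [mul_assoc, ← ENNReal.ofReal_mul (by positivity), ← Real.rpow_add ht]
        ring_nf
      · rw [distFn_eq_zero_of_linftyNorm_le ht.le
          (hMg.le.trans (ENNReal.ofReal_le_ofReal (not_le.1 htM).le)), zero_mul]
        exact zero_le
    · rw [Set.indicator_of_notMem (by simpa using ht)]
      exact zero_le
  rw [lintegral_const_mul _ (by fun_prop), lintegral_Ioc_rpow hqp hM0] at hbound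
  rw [hcake, hMg, ENNReal.ofReal_rpow_of_nonneg hM0 hqp.le]
  refine (mul_le_mul_right hbound _).trans_eq ?_
  rw [mul_right_comm, ← ENNReal.ofReal_mul (by positivity), mul_left_comm,
    ← ENNReal.ofReal_mul hq.le, mul_comm]
  congr 2
  ring

theorem linftyNorm_indicator_le (f : En n → ℝ) (s : Set (En n)) :
    linftyNorm (s.indicator f) ≤ linftyNorm f := by
  refine essSup_mono_ae (.of_forall fun x => ENNReal.ofReal_le_ofReal ?_)
  by_cases hx : x ∈ s <;> simp [hx]

theorem morreyNorm_le {f : En n → ℝ} (hf : Measurable f) {p q : ℝ} (κ : ℝ)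
    (hp : 0 < p) (hpq : p < q) (hM : linftyNorm f ≠ ∞) :
    morreyNorm f q κ ≤ ENNReal.ofReal ((q / (q - p)) ^ (1 / q)) *
      lmNorm f p ∞ κ ^ (p / q) * linftyNorm f ^ (1 - p / q) := by
  have hq : 0 < q := hp.trans hpq
  have hqp : 0 < q - p := sub_pos.2 hpq
  refine iSup_le fun c => iSup_le fun ρ => iSup_le fun hρ => ?_
  set B := Metric.ball c ρ with hB
  have hle : ∫⁻ x in B, ENNReal.ofReal |f x| ^ q ≤ ENNReal.ofReal (q / (q - p)) *
      lorentzNorm (B.indicator f) p ∞ ^ p * linftyNorm f ^ (q - p) := by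
    have hind := linftyNorm_indicator_le f B
    have h := lintegral_rpow_le_lorentzNorm_top (hf.indicator measurableSet_ball) hp hpq
      (ne_top_of_le_ne_top hM hind)
    refine (Eq.trans_le ?_ h).trans (by gcongr)
    rw [← lintegral_indicator measurableSet_ball]
    refine lintegral_congr fun x => ?_
    by_cases hx : x ∈ B <;> simp [← hB, hx, hq]
  have hlm : volume B ^ (-(κ / p)) * lorentzNorm (B.indicator f) p ∞ ≤ lmNorm f p ∞ κ :=
    le_iSup_of_le c (le_iSup_of_le ρ (le_iSup_of_le hρ le_rfl))
  calc volume B ^ (-(κ / q)) * (∫⁻ x in B, ENNReal.ofReal |f x| ^ q) ^ (1 / q)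
      ≤ volume B ^ (-(κ / q)) * (ENNReal.ofReal (q / (q - p)) *
          lorentzNorm (B.indicator f) p ∞ ^ p * linftyNorm f ^ (q - p)) ^ (1 / q) := by gcongr
    _ = ENNReal.ofReal ((q / (q - p)) ^ (1 / q)) *
          (volume B ^ (-(κ / p)) * lorentzNorm (B.indicator f) p ∞) ^ (p / q) *
          linftyNorm f ^ (1 - p / q) := by
        have h1q : 0 ≤ 1 / q := by positivity
        rw [ENNReal.mul_rpow_of_nonneg _ _ h1q, ENNReal.mul_rpow_of_nonneg _ _ h1q,
          ENNReal.mul_rpow_of_nonneg _ _ (by positivity), ← ENNReal.rpow_mul,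
          ← ENNReal.rpow_mul, ← ENNReal.rpow_mul,
          ENNReal.ofReal_rpow_of_nonneg (by positivity) h1q]
        have e1 : -(κ / p) * (p / q) = -(κ / q) := by field_simp
        have e2 : p * (1 / q) = p / q := by ring
        have e3 : (q - p) * (1 / q) = 1 - p / q := by field_simp
        rw [e1, e2, e3]
        ring
    _ ≤ _ := by gcongr

theorem stmt5 (n : ℕ) (p q κ : ℝ) (hp : 1 ≤ p) (hpq : p < q)
    (hκ0 : 0 < κ) (hκ1 : κ < 1)
    (f : En n → ℝ) (hf : Measurable f)
    (hLM : lmNorm f p ∞ κ ≠ ∞)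
    (hLinf : linftyNorm f ≠ ∞) :
    morreyNorm f q κ ≠ ∞ ∧
      morreyNorm f q κ ≤
        ENNReal.ofReal ((2 : ℝ) ^ (1 - 1 / q) * (q / (q - p)) ^ (1 / q)) *
          lmNorm f p ∞ κ ^ (p / q) * linftyNorm f ^ (1 - p / q) := by
  have hq : 0 < q := by linarith
  have hqp : 0 < q - p := sub_pos.2 hpq
  have key : morreyNorm f q κ ≤
      ENNReal.ofReal ((2 : ℝ) ^ (1 - 1 / q) * (q / (q - p)) ^ (1 / q)) *
        lmNorm f p ∞ κ ^ (p / q) * linftyNorm f ^ (1 - p / q) := by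
    refine (morreyNorm_le hf κ (by linarith) hpq hLinf).trans ?_
    gcongr
    refine le_mul_of_one_le_left (by positivity)
      (Real.one_le_rpow one_le_two (sub_nonneg.2 ?_))
    exact (div_le_one hq).2 (by linarith)
  refine ⟨ne_top_of_le_ne_top ?_ key, key⟩
  have hpq' : 0 ≤ 1 - p / q := sub_nonneg.2 ((div_le_one hq).2 hpq.le)
  exact ENNReal.mul_ne_top (ENNReal.mul_ne_top ENNReal.ofReal_ne_top
    (ENNReal.rpow_ne_top_of_nonneg (by positivity) hLM))
    (ENNReal.rpow_ne_top_of_nonneg hpq' hLinf)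
end
end

section
/- Let 1 ≤ q < p < ∞, 0 < κ* < 1, 0 < κ < 1, q ≤ r < ∞, and suppose (1−κ)p = (1−κ*)q. Then every measurable f on ℝ^n with ‖f‖_{LM^{p,∞;κ*}} < ∞ satisfies ‖f‖_{LM^{q,r;κ}} ≤ [pq/(r(p−q))]^{1/r} · ‖f‖_{LM^{p,∞;κ*}}; in particular LM^{p,∞;κ*}(ℝ^n) ⊂ LM^{q,r;κ}(ℝ^n). -/
open MeasureTheory ENNReal

noncomputable section

variable {n : ℕ}

lemma rearr_eq_zero_of_volume_support_le (g : En n → ℝ) {s : ℝ}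
    (hs : volume (Function.support g) ≤ ENNReal.ofReal s) : rearr g s = 0 := by
  refine le_antisymm (_root_.le_of_forall_pos_le_add fun ε hε => ?_) zero_le
  rw [zero_add]
  rcases eq_or_ne ε ∞ with rfl | hεtop
  · exact le_top
  refine sInf_le ⟨ε.toReal, ⟨ENNReal.toReal_pos hε.ne' hεtop, ?_⟩, ENNReal.ofReal_toReal hεtop⟩
  refine (measure_mono fun x hx => ?_).trans hs
  exact abs_pos.mp (ENNReal.toReal_nonneg.trans_lt hx)

lemma lintegral_rpow_Ioc {a V : ℝ} (ha : 0 < a) (hV : 0 ≤ V) :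
    ∫⁻ s in Set.Ioc (0 : ℝ) V, ENNReal.ofReal (s ^ (a - 1)) = ENNReal.ofReal (V ^ a / a) := by
  have hint : IntegrableOn (fun s : ℝ => s ^ (a - 1)) (Set.Ioc 0 V) :=
    (intervalIntegrable_iff_integrableOn_Ioc_of_le hV).mp
      (intervalIntegral.intervalIntegrable_rpow' (by linarith))
  rw [← ofReal_integral_eq_lintegral_ofReal hint
    ((ae_restrict_mem measurableSet_Ioc).mono fun s hs => Real.rpow_nonneg hs.1.le _),
    ← intervalIntegral.integral_of_le hV, integral_rpow (Or.inl (by linarith))]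
  simp [Real.zero_rpow ha.ne']

/-- On sets of measure at most `V`, the space `L^{p,∞}` embeds in `L^{q,r}` for `q < p`. -/
lemma lorentzNorm_le_of_volume_support_le (g : En n → ℝ) {p q r V : ℝ} (hq : 0 < q)
    (hqp : q < p) (hr : 0 < r) (hV : 0 ≤ V)
    (hsupp : volume (Function.support g) ≤ ENNReal.ofReal V) (hg : lorentzNorm g p ∞ ≠ ∞) :
    lorentzNorm g q (ENNReal.ofReal r) ≤
      ENNReal.ofReal ((p * q / (r * (p - q))) ^ (1 / r)) *
        ENNReal.ofReal (V ^ (1 / q - 1 / p)) * lorentzNorm g p ∞ := by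
  have hp : 0 < p := hq.trans hqp
  have hd : 0 < 1 / q - 1 / p := sub_pos.mpr (one_div_lt_one_div_of_lt hq hqp)
  set A := lorentzNorm g p ∞ with hA
  set a := r * (1 / q - 1 / p) with ha_def
  have ha : 0 < a := mul_pos hr hd
  have hbound : ∀ s : ℝ, 0 < s → ENNReal.ofReal (s ^ (1 / p)) * rearr g s ≤ A := by
    intro s hs
    rw [hA, lorentzNorm, if_pos rfl]
    exact le_iSup₂ (f := fun (s : ℝ) (_ : 0 < s) => ENNReal.ofReal (s ^ (1 / p)) * rearr g s) s hs
  have hpoint : ∀ s ∈ Set.Ioi (0 : ℝ),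
      (ENNReal.ofReal (s ^ (1 / q)) * rearr g s) ^ r / ENNReal.ofReal s ≤
        (Set.Ioc (0 : ℝ) V).indicator (fun s => A ^ r * ENNReal.ofReal (s ^ (a - 1))) s := by
    intro s hs
    have hs : 0 < s := hs
    by_cases hsV : s ≤ V
    · rw [Set.indicator_of_mem (show s ∈ Set.Ioc 0 V from ⟨hs, hsV⟩)]
      have h1 : ENNReal.ofReal (s ^ (1 / q)) * rearr g s ≤
          A * ENNReal.ofReal (s ^ (1 / q - 1 / p)) := by
        have : s ^ (1 / q) = s ^ (1 / q - 1 / p) * s ^ (1 / p) := by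
          rw [← Real.rpow_add hs, sub_add_cancel]
        rw [this, ENNReal.ofReal_mul (by positivity), mul_assoc, mul_comm A]
        gcongr
        exact hbound s hs
      calc _ ≤ (A * ENNReal.ofReal (s ^ (1 / q - 1 / p))) ^ r / ENNReal.ofReal s := by gcongr
        _ = _ := by
          rw [ENNReal.mul_rpow_of_nonneg _ _ hr.le,
            ENNReal.ofReal_rpow_of_nonneg (by positivity) hr.le, mul_div_assoc,
            ← ENNReal.ofReal_div_of_pos hs, ← Real.rpow_mul hs.le, Real.rpow_sub_one hs.ne',
            mul_comm _ r]
    · rw [rearr_eq_zero_of_volume_support_le g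
        (hsupp.trans (ENNReal.ofReal_le_ofReal (not_le.mp hsV).le))]
      simp [hr]
  have hK : (p * q / (r * (p - q))) = 1 / a := by
    have : p - q ≠ 0 := (sub_pos.mpr hqp).ne'
    rw [ha_def]
    field_simp
  rw [lorentzNorm, if_neg ENNReal.ofReal_ne_top, ENNReal.toReal_ofReal hr.le]
  calc _ ≤ (A ^ r * ENNReal.ofReal (V ^ a / a)) ^ (1 / r) := by
        gcongr
        refine (setLIntegral_mono' measurableSet_Ioi hpoint).trans ?_
        refine (setLIntegral_le_lintegral _ _).trans ?_
        rw [lintegral_indicator measurableSet_Ioc,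
          lintegral_const_mul' _ _ (ENNReal.rpow_ne_top_of_nonneg hr.le hg),
          lintegral_rpow_Ioc ha hV]
    _ = _ := by
        rw [ENNReal.mul_rpow_of_nonneg _ _ (by positivity), ← ENNReal.rpow_mul,
          mul_one_div_cancel hr.ne', ENNReal.rpow_one,
          ENNReal.ofReal_rpow_of_nonneg (by positivity) (by positivity), hK,
          ← ENNReal.ofReal_mul (by positivity), mul_comm A]
        congr 2
        rw [div_eq_mul_one_div, Real.mul_rpow (by positivity) (by positivity),
          ← Real.rpow_mul hV, ha_def, mul_comm]
        congr 2
        field_simp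

theorem stmt7 (n : ℕ) (p q r κs κ : ℝ) (hq1 : 1 ≤ q) (hqp : q < p)
    (hκs0 : 0 < κs) (hκs1 : κs < 1) (hκ0 : 0 < κ) (hκ1 : κ < 1)
    (hqr : q ≤ r) (hrel : (1 - κ) * p = (1 - κs) * q)
    (f : En n → ℝ) (hf : Measurable f)
    (hfin : lmNorm f p ∞ κs ≠ ∞) :
    lmNorm f q (ENNReal.ofReal r) κ ≠ ∞ ∧
      lmNorm f q (ENNReal.ofReal r) κ ≤
        ENNReal.ofReal ((p * q / (r * (p - q))) ^ (1 / r)) * lmNorm f p ∞ κs := by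
  have hq : 0 < q := by linarith
  have hp : 0 < p := hq.trans hqp
  refine (fun h => ⟨ne_top_of_le_ne_top (ENNReal.mul_ne_top ENNReal.ofReal_ne_top hfin) h, h⟩) ?_
  rw [lmNorm]
  refine iSup_le fun c => iSup_le fun ρ => iSup_le fun hρ => ?_
  set V := volume (Metric.ball c ρ) with hV
  have hV0 : V ≠ 0 := (Metric.measure_ball_pos volume c hρ).ne'
  have hVtop : V ≠ ∞ := measure_ball_lt_top.ne
  set g := (Metric.ball c ρ).indicator f with hg
  have hball : V ^ (-(κs / p)) * lorentzNorm g p ∞ ≤ lmNorm f p ∞ κs :=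
    le_iSup_of_le c (le_iSup₂_of_le ρ hρ le_rfl)
  have hVκ : V ^ (-(κs / p)) ≠ 0 := (ENNReal.rpow_pos (pos_iff_ne_zero.mpr hV0) hVtop).ne'
  have hgfin : lorentzNorm g p ∞ ≠ ∞ := fun h =>
    ne_top_of_le_ne_top hfin hball (by rw [h, ENNReal.mul_top hVκ])
  have hsupp : volume (Function.support g) ≤ ENNReal.ofReal V.toReal := by
    rw [ENNReal.ofReal_toReal hVtop]
    exact measure_mono Set.support_indicator_subset
  have hexp : -(κ / q) + (1 / q - 1 / p) = -(κs / p) := by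
    field_simp
    linarith
  have hpow : V ^ (-(κ / q)) * ENNReal.ofReal (V.toReal ^ (1 / q - 1 / p)) = V ^ (-(κs / p)) := by
    rw [← ENNReal.ofReal_rpow_of_pos (ENNReal.toReal_pos hV0 hVtop),
      ENNReal.ofReal_toReal hVtop, ← ENNReal.rpow_add _ _ hV0 hVtop, hexp]
  calc _ ≤ V ^ (-(κ / q)) * (ENNReal.ofReal ((p * q / (r * (p - q))) ^ (1 / r)) *
        ENNReal.ofReal (V.toReal ^ (1 / q - 1 / p)) * lorentzNorm g p ∞) := by
        gcongr
        exact lorentzNorm_le_of_volume_support_le g hq hqp (hq.trans_le hqr)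
          ENNReal.toReal_nonneg hsupp hgfin
    _ = ENNReal.ofReal ((p * q / (r * (p - q))) ^ (1 / r)) *
        (V ^ (-(κs / p)) * lorentzNorm g p ∞) := by
        rw [← hpow]
        ring
    _ ≤ _ := by gcongr
end
end

section
/- Let 1 ≤ q < p < ∞, 0 < κ* < 1, 0 < κ < 1, and suppose (1−κ)p = (1−κ*)q. Then every measurable f on ℝ^n with ‖f‖_{WM^{p;κ*}} < ∞ satisfies ‖f‖_{M^{q;κ}} ≤ [p/(p−q)]^{1/q} · ‖f‖_{WM^{p;κ*}}; in particular the weak Morrey space WM^{p;κ*}(ℝ^n) is contained in the Morrey space M^{q;κ}(ℝ^n). -/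
open MeasureTheory ENNReal

noncomputable section

variable {n : ℕ}

/-- On a measure space of total mass at most `m`, weak `L^p` embeds in `L^q` for `q < p`. -/
theorem lintegral_rpow_le_of_weak_bound {α : Type*} [MeasurableSpace α] (μ : Measure α)
    {f : α → ℝ} (hf : Measurable f) {p q A m : ℝ} (hq : 0 < q) (hqp : q < p)
    (hA : 0 < A) (hm : 0 < m) (hμ : μ Set.univ ≤ ENNReal.ofReal m)
    (h : ∀ l : ℝ, 0 < l →
      ENNReal.ofReal l * μ {x | l < |f x|} ^ (1 / p) ≤ ENNReal.ofReal A) :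
    ∫⁻ x, ENNReal.ofReal |f x| ^ q ∂μ ≤
      ENNReal.ofReal (p / (p - q) * (A ^ q * m ^ (1 - q / p))) := by
  have hp : 0 < p := hq.trans hqp
  have hpq : 0 < p - q := sub_pos.2 hqp
  set T : ℝ := A * m ^ (-(1 / p)) with hT
  have hTpos : 0 < T := by positivity
  have hdist : ∀ l : ℝ, 0 < l → μ {x | l < |f x|} ≤ ENNReal.ofReal (A ^ p * l ^ (-p)) := by
    intro l hl
    have h1 : μ {x | l < |f x|} ^ (1 / p) ≤ ENNReal.ofReal (A / l) := by
      rw [ENNReal.ofReal_div_of_pos hl, ENNReal.le_div_iff_mul_le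
        (Or.inl (by simpa using hl)) (Or.inl ENNReal.ofReal_ne_top), mul_comm]
      exact h l hl
    have h2 := ENNReal.rpow_le_rpow h1 hp.le
    rw [← ENNReal.rpow_mul, one_div_mul_cancel hp.ne', ENNReal.rpow_one,
      ENNReal.ofReal_rpow_of_pos (by positivity), Real.div_rpow hA.le hl.le] at h2
    rwa [Real.rpow_neg hl.le, ← div_eq_mul_inv]
  have hlayer : ∫⁻ x, ENNReal.ofReal |f x| ^ q ∂μ =
      ENNReal.ofReal q * ∫⁻ t in Set.Ioi 0, μ {x | t < |f x|} * ENNReal.ofReal (t ^ (q - 1)) := by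
    rw [← lintegral_rpow_eq_lintegral_meas_lt_mul μ
      (Filter.Eventually.of_forall fun x => abs_nonneg (f x)) hf.abs.aemeasurable hq]
    exact lintegral_congr fun x => ENNReal.ofReal_rpow_of_nonneg (abs_nonneg _) hq.le
  have hlow : ∫⁻ t in Set.Ioc 0 T, μ {x | t < |f x|} * ENNReal.ofReal (t ^ (q - 1)) ≤
      ENNReal.ofReal (m * (T ^ q / q)) := by
    have hint : IntegrableOn (fun t : ℝ => m * t ^ (q - 1)) (Set.Ioc 0 T) :=
      ((intervalIntegrable_iff_integrableOn_Ioc_of_le hTpos.le).1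
        (intervalIntegral.intervalIntegrable_rpow' (by linarith))).const_mul m
    calc _ ≤ ∫⁻ t in Set.Ioc 0 T, ENNReal.ofReal (m * t ^ (q - 1)) := by
          refine setLIntegral_mono' measurableSet_Ioc fun t ht => ?_
          rw [ENNReal.ofReal_mul hm.le]
          gcongr
          exact (measure_mono (Set.subset_univ _)).trans hμ
      _ = ENNReal.ofReal (∫ t in Set.Ioc 0 T, m * t ^ (q - 1)) := by
          refine (ofReal_integral_eq_lintegral_ofReal hint ?_).symm
          filter_upwards [ae_restrict_mem measurableSet_Ioc] with t ht
          exact mul_nonneg hm.le (Real.rpow_nonneg ht.1.le _)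
      _ = _ := by
          rw [← intervalIntegral.integral_of_le hTpos.le, intervalIntegral.integral_const_mul,
            integral_rpow (Or.inl (by linarith)), sub_add_cancel, Real.zero_rpow hq.ne', sub_zero]
  have hhigh : ∫⁻ t in Set.Ioi T, μ {x | t < |f x|} * ENNReal.ofReal (t ^ (q - 1)) ≤
      ENNReal.ofReal (A ^ p * (T ^ (q - p) / (p - q))) := by
    have hint : IntegrableOn (fun t : ℝ => A ^ p * t ^ (q - p - 1)) (Set.Ioi T) :=
      (integrableOn_Ioi_rpow_of_lt (by linarith) hTpos).const_mul _
    calc _ ≤ ∫⁻ t in Set.Ioi T, ENNReal.ofReal (A ^ p * t ^ (q - p - 1)) := by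
          refine setLIntegral_mono' measurableSet_Ioi fun t ht => ?_
          have ht0 : 0 < t := hTpos.trans ht
          rw [show q - p - 1 = -p + (q - 1) by ring, Real.rpow_add ht0, ← mul_assoc,
            ENNReal.ofReal_mul (by positivity)]
          gcongr
          exact hdist t ht0
      _ = ENNReal.ofReal (∫ t in Set.Ioi T, A ^ p * t ^ (q - p - 1)) := by
          refine (ofReal_integral_eq_lintegral_ofReal hint ?_).symm
          filter_upwards [ae_restrict_mem measurableSet_Ioi] with t ht
          have ht0 : 0 < t := hTpos.trans ht
          positivity
      _ = _ := by
          rw [integral_const_mul, integral_Ioi_rpow_of_lt (by linarith) hTpos, sub_add_cancel,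
            ← neg_sub p q, div_neg, neg_div, neg_neg]
  rw [hlayer, ← Set.Ioc_union_Ioi_eq_Ioi hTpos.le,
    lintegral_union measurableSet_Ioi Set.Ioc_disjoint_Ioi_same]
  refine (mul_le_mul_right (add_le_add hlow hhigh) _).trans (le_of_eq ?_)
  rw [← ENNReal.ofReal_add (by positivity) (by positivity), ← ENNReal.ofReal_mul hq.le]
  congr 1
  have e1 : m * T ^ q = A ^ q * m ^ (1 - q / p) := by
    rw [hT, Real.mul_rpow hA.le (by positivity), ← Real.rpow_mul hm.le, mul_left_comm,
      ← Real.rpow_one_add' hm.le]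
    · congr 2; ring
    · rw [show 1 + -(1 / p) * q = (p - q) / p by field_simp; ring]
      positivity
  have e2 : A ^ p * T ^ (q - p) = A ^ q * m ^ (1 - q / p) := by
    rw [hT, Real.mul_rpow hA.le (by positivity), ← Real.rpow_mul hm.le, ← mul_assoc,
      ← Real.rpow_add hA]
    congr 2
    · ring
    · field_simp; ring
  rw [mul_div_assoc', mul_div_assoc', e1, e2]
  field_simp
  ring

theorem stmt8 (n : ℕ) (p q κs κ : ℝ) (hq1 : 1 ≤ q) (hqp : q < p)
    (hκs0 : 0 < κs) (hκs1 : κs < 1) (hκ0 : 0 < κ) (hκ1 : κ < 1)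
    (hrel : (1 - κ) * p = (1 - κs) * q)
    (f : En n → ℝ) (hf : Measurable f)
    (hfin : wMorreyNorm f p κs ≠ ∞) :
    morreyNorm f q κ ≠ ∞ ∧
      morreyNorm f q κ ≤
        ENNReal.ofReal ((p / (p - q)) ^ (1 / q)) * wMorreyNorm f p κs := by
  have hq : 0 < q := by linarith
  have hp : 0 < p := by linarith
  have hpq : 0 < p - q := sub_pos.2 hqp
  suffices hmain : morreyNorm f q κ ≤
      ENNReal.ofReal ((p / (p - q)) ^ (1 / q)) * wMorreyNorm f p κs from
    ⟨ne_top_of_le_ne_top (ENNReal.mul_ne_top ENNReal.ofReal_ne_top hfin) hmain, hmain⟩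
  refine iSup_le fun c => iSup_le fun ρ => iSup_le fun hρ => ?_
  obtain ⟨m, hm, hvol⟩ : ∃ m : ℝ, 0 < m ∧ volume (Metric.ball c ρ) = ENNReal.ofReal m :=
    ⟨_, ENNReal.toReal_pos (Metric.measure_ball_pos volume c hρ).ne' measure_ball_lt_top.ne,
      (ENNReal.ofReal_toReal measure_ball_lt_top.ne).symm⟩
  have hbound : ∀ w : ℝ, 0 < w → wMorreyNorm f p κs ≤ ENNReal.ofReal w →
      volume (Metric.ball c ρ) ^ (-(κ / q)) *
        (∫⁻ x in Metric.ball c ρ, ENNReal.ofReal |f x| ^ q) ^ (1 / q) ≤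
      ENNReal.ofReal ((p / (p - q)) ^ (1 / q)) * ENNReal.ofReal w := by
    intro w hw hle
    have hint := lintegral_rpow_le_of_weak_bound (volume.restrict (Metric.ball c ρ)) hf hq hqp
      (A := m ^ (κs / p) * w) (m := m) (by positivity) hm (by simp [hvol]) (fun l hl => by
        have h1 : volume (Metric.ball c ρ) ^ (-(κs / p)) *
            (ENNReal.ofReal l * volume {x ∈ Metric.ball c ρ | l < |f x|} ^ (1 / p)) ≤
            ENNReal.ofReal w := by
          refine le_trans ?_ hle
          unfold wMorreyNorm
          refine le_iSup_of_le c <| le_iSup_of_le ρ <| le_iSup_of_le hρ ?_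
          exact mul_le_mul_right
            (le_iSup₂ (f := fun (l : ℝ) (_ : 0 < l) =>
              ENNReal.ofReal l * volume {x ∈ Metric.ball c ρ | l < |f x|} ^ (1 / p)) l hl) _
        rw [Measure.restrict_apply (measurableSet_lt measurable_const hf.abs), Set.inter_comm]
        rw [hvol, ENNReal.ofReal_rpow_of_pos hm] at h1
        have h2 := mul_le_mul_right h1 (ENNReal.ofReal (m ^ (κs / p)))
        rwa [← mul_assoc, ← ENNReal.ofReal_mul (by positivity), ← Real.rpow_add hm,
          add_neg_cancel, Real.rpow_zero, ENNReal.ofReal_one, one_mul,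
          ← ENNReal.ofReal_mul (by positivity)] at h2)
    refine (mul_le_mul_right (ENNReal.rpow_le_rpow hint (by positivity)) _).trans (le_of_eq ?_)
    rw [hvol, ENNReal.ofReal_rpow_of_pos hm, ENNReal.ofReal_rpow_of_pos (by positivity),
      ← ENNReal.ofReal_mul (by positivity), ← ENNReal.ofReal_mul (by positivity)]
    congr 1
    have hexp : κ / q = κs / p + (1 - q / p) * (1 / q) := by
      field_simp
      linarith
    rw [Real.mul_rpow (by positivity) (by positivity), Real.mul_rpow (by positivity) (by positivity),
      ← Real.rpow_mul (by positivity), mul_one_div_cancel hq.ne', Real.rpow_one,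
      ← Real.rpow_mul hm.le]
    have hone : m ^ (-(κ / q)) * (m ^ (κs / p) * m ^ ((1 - q / p) * (1 / q))) = 1 := by
      rw [← Real.rpow_add hm, ← Real.rpow_add hm, ← hexp, neg_add_cancel, Real.rpow_zero]
    linear_combination (p / (p - q)) ^ (1 / q) * w * hone
  have hlim : Filter.Tendsto
      (fun w : ℝ => ENNReal.ofReal ((p / (p - q)) ^ (1 / q)) * ENNReal.ofReal w)
      (nhdsWithin (wMorreyNorm f p κs).toReal (Set.Ioi (wMorreyNorm f p κs).toReal))
      (nhds (ENNReal.ofReal ((p / (p - q)) ^ (1 / q)) * wMorreyNorm f p κs)) := by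
    have h := ENNReal.Tendsto.const_mul (a := ENNReal.ofReal ((p / (p - q)) ^ (1 / q)))
      (ENNReal.continuous_ofReal.tendsto (wMorreyNorm f p κs).toReal)
      (Or.inr ENNReal.ofReal_ne_top)
    rw [ENNReal.ofReal_toReal hfin] at h
    exact h.mono_left nhdsWithin_le_nhds
  refine ge_of_tendsto hlim ?_
  filter_upwards [self_mem_nhdsWithin] with w (hw : (wMorreyNorm f p κs).toReal < w)
  exact hbound w (ENNReal.toReal_nonneg.trans_lt hw)
    ((ENNReal.le_ofReal_iff_toReal_le hfin (ENNReal.toReal_nonneg.trans_lt hw).le).2 hw.le)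
end
end

section
/- Let f be a measurable function on ℝ^n such that f**(t) < ∞ for every t > 0 and ‖f‖_𝒲 < ∞. Then for all 0 < s < t one has f**(s) ≤ f**(t) + ‖f‖_𝒲 · log(t/s). -/
open MeasureTheory ENNReal

noncomputable section

variable {n : ℕ}

theorem ofReal_mul_doubleStar (f : En n → ℝ) {t : ℝ} (ht : 0 < t) :
    ENNReal.ofReal t * doubleStar f t = ∫⁻ τ in Set.Ioc (0 : ℝ) t, rearr f τ :=
  ENNReal.mul_inv_cancel_left (ENNReal.ofReal_pos.2 ht).ne' ENNReal.ofReal_ne_top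

theorem doubleStar_le_wNorm_add_rearr (f : En n → ℝ) {t : ℝ} (ht : 0 < t) :
    doubleStar f t ≤ wNorm f + rearr f t :=
  tsub_le_iff_right.1 (le_iSup₂_of_le t ht le_rfl)

theorem ofReal_sub_mul_rearr_le (f : En n → ℝ) (a b : ℝ) :
    ENNReal.ofReal (b - a) * rearr f b ≤ ∫⁻ τ in Set.Ioc a b, rearr f τ := by
  calc ENNReal.ofReal (b - a) * rearr f b = ∫⁻ _ in Set.Ioc a b, rearr f b := by
        rw [setLIntegral_const, Real.volume_Ioc, mul_comm]
    _ ≤ _ := setLIntegral_mono' measurableSet_Ioc fun _ hx => rearr_antitone f hx.2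

theorem rearr_le_doubleStar (f : En n → ℝ) {t : ℝ} (ht : 0 < t) :
    rearr f t ≤ doubleStar f t := by
  have h := ofReal_sub_mul_rearr_le f 0 t
  rw [sub_zero, ← ofReal_mul_doubleStar f ht] at h
  exact (ENNReal.mul_le_mul_iff_right (ENNReal.ofReal_pos.2 ht).ne' ENNReal.ofReal_ne_top).1 h

theorem toReal_doubleStar_le_add_mul_sub (f : En n → ℝ)
    (hfin : ∀ t : ℝ, 0 < t → doubleStar f t ≠ ∞) (hW : wNorm f ≠ ∞)
    {a b : ℝ} (ha : 0 < a) (hab : a ≤ b) :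
    (doubleStar f a).toReal ≤
      (doubleStar f b).toReal + (wNorm f).toReal * (b / a - 1) := by
  have hb : 0 < b := ha.trans_le hab
  have hr : rearr f b ≠ ∞ := ne_top_of_le_ne_top (hfin b hb) (rearr_le_doubleStar f hb)
  have hsplit : ENNReal.ofReal a * doubleStar f a + ENNReal.ofReal (b - a) * rearr f b ≤
      ENNReal.ofReal b * doubleStar f b := by
    rw [ofReal_mul_doubleStar f ha, ofReal_mul_doubleStar f hb,
      ← Set.Ioc_union_Ioc_eq_Ioc ha.le hab,
      lintegral_union measurableSet_Ioc (Set.Ioc_disjoint_Ioc_of_le le_rfl)]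
    gcongr
    exact ofReal_sub_mul_rearr_le f a b
  have h1 := ENNReal.toReal_mono (ENNReal.mul_ne_top ENNReal.ofReal_ne_top (hfin b hb)) hsplit
  have h2 := ENNReal.toReal_mono (ENNReal.add_ne_top.2 ⟨hW, hr⟩)
    (doubleStar_le_wNorm_add_rearr f hb)
  rw [ENNReal.toReal_add (ENNReal.mul_ne_top ENNReal.ofReal_ne_top (hfin a ha))
    (ENNReal.mul_ne_top ENNReal.ofReal_ne_top hr)] at h1
  rw [ENNReal.toReal_add hW hr] at h2
  simp only [ENNReal.toReal_mul, ENNReal.toReal_ofReal ha.le, ENNReal.toReal_ofReal hb.le,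
    ENNReal.toReal_ofReal (sub_nonneg.2 hab)] at h1
  have h3 := mul_le_mul_of_nonneg_left h2 (sub_nonneg.2 hab)
  have h4 : a * ((wNorm f).toReal * (b / a - 1)) = (wNorm f).toReal * (b - a) := by
    field_simp
  refine le_of_mul_le_mul_left ?_ ha
  rw [mul_add, h4]
  linarith

theorem toReal_doubleStar_le_add_mul_pow (f : En n → ℝ)
    (hfin : ∀ t : ℝ, 0 < t → doubleStar f t ≠ ∞) (hW : wNorm f ≠ ∞)
    {s r : ℝ} (hs : 0 < s) (hr : 1 ≤ r) (N : ℕ) :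
    (doubleStar f s).toReal ≤
      (doubleStar f (s * r ^ N)).toReal + (wNorm f).toReal * (N * (r - 1)) := by
  have hr0 : 0 < r := one_pos.trans_le hr
  induction N with
  | zero => simp
  | succ N ih =>
    have hpos : 0 < s * r ^ N := by positivity
    have h := toReal_doubleStar_le_add_mul_sub f hfin hW (b := s * r ^ (N + 1)) hpos
      (by gcongr; omega)
    have hdiv : s * r ^ (N + 1) / (s * r ^ N) = r := by
      rw [pow_succ]
      field_simp
    rw [hdiv] at h
    push_cast
    linarith

theorem tendsto_nat_mul_exp_div_sub_one (x : ℝ) :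
    Filter.Tendsto (fun N : ℕ => (N : ℝ) * (Real.exp (x / N) - 1)) Filter.atTop (nhds x) := by
  have hd : HasDerivAt (fun y : ℝ => Real.exp (x * y)) x 0 := by
    simpa using ((hasDerivAt_id (0 : ℝ)).const_mul x).exp
  have ht : Filter.Tendsto (fun N : ℕ => ((N : ℝ))⁻¹) Filter.atTop (nhdsWithin 0 {0}ᶜ) := by
    refine tendsto_nhdsWithin_iff.2 ⟨tendsto_inv_atTop_nhds_zero_nat, ?_⟩
    filter_upwards [Filter.eventually_gt_atTop 0] with N hN
    simpa using hN.ne'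
  have := hd.tendsto_slope_zero.comp ht
  simpa [Function.comp_def, div_eq_mul_inv] using this

theorem stmt10 (n : ℕ) (f : En n → ℝ) (hf : Measurable f)
    (hfin : ∀ t : ℝ, 0 < t → doubleStar f t ≠ ∞) (hW : wNorm f ≠ ∞)
    (s t : ℝ) (hs : 0 < s) (hst : s < t) :
    doubleStar f s ≤ doubleStar f t + wNorm f * ENNReal.ofReal (Real.log (t / s)) := by
  have hpos : 0 < t / s := div_pos (hs.trans hst) hs
  have hlog : 0 ≤ Real.log (t / s) := Real.log_nonneg ((one_le_div hs).2 hst.le)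
  have hreal : (doubleStar f s).toReal ≤
      (doubleStar f t).toReal + (wNorm f).toReal * Real.log (t / s) := by
    refine ge_of_tendsto (((tendsto_nat_mul_exp_div_sub_one (Real.log (t / s))).const_mul
      (wNorm f).toReal).const_add (doubleStar f t).toReal) ?_
    filter_upwards [Filter.eventually_gt_atTop 0] with N hN
    have h := toReal_doubleStar_le_add_mul_pow f hfin hW hs
      (Real.one_le_exp (div_nonneg hlog N.cast_nonneg)) N
    have hN' : (N : ℝ) ≠ 0 := Nat.cast_ne_zero.2 hN.ne'
    rwa [← Real.exp_nat_mul, mul_div_cancel₀ _ hN', Real.exp_log hpos,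
      mul_div_cancel₀ _ hs.ne'] at h
  have ht := hfin t (hs.trans hst)
  have hm := ENNReal.mul_ne_top hW (ENNReal.ofReal_ne_top (r := Real.log (t / s)))
  rw [← ENNReal.toReal_le_toReal (hfin s hs) (ENNReal.add_ne_top.2 ⟨ht, hm⟩),
    ENNReal.toReal_add ht hm, ENNReal.toReal_mul, ENNReal.toReal_ofReal hlog]
  exact hreal
end
end

section
/- Let n ∈ ℕ. There exist constants α > 0 and C > 0 depending only on n such that for every f ∈ L¹(ℝ^n) ∩ BMO(ℝ^n) with ‖f‖_{BMO} > 0 and every λ > ‖f‖_{BMO}, m({x ∈ ℝ^n : |f(x)| > λ}) ≤ C · (‖f‖_{L¹} / ‖f‖_{BMO}) · exp(−α λ / ‖f‖_{BMO}). -/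
open MeasureTheory ENNReal

noncomputable section

variable {n : ℕ}

/-- Chebyshev's inequality for the oscillation of `f` over a ball. -/
lemma mul_measureReal_oscillation_le {f : En n → ℝ} (hf : Measurable f) (hfin : bmoNorm f ≠ ∞)
    (c : En n) {ρ : ℝ} (hρ : 0 < ρ) {t : ℝ} (ht : 0 ≤ t) :
    t * volume.real (Metric.ball c ρ ∩ {x | t ≤ |f x - ballAvg f c ρ|}) ≤
      (bmoNorm f).toReal * volume.real (Metric.ball c ρ) := by
  have hVtop : volume (Metric.ball c ρ) ≠ ∞ := measure_ball_lt_top.ne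
  have hV0 : volume (Metric.ball c ρ) ≠ 0 := (Metric.measure_ball_pos volume c hρ).ne'
  have hosc : ∫⁻ x in Metric.ball c ρ, ENNReal.ofReal |f x - ballAvg f c ρ| ≤
      bmoNorm f * volume (Metric.ball c ρ) := by
    have h : (volume (Metric.ball c ρ))⁻¹ *
        ∫⁻ x in Metric.ball c ρ, ENNReal.ofReal |f x - ballAvg f c ρ| ≤ bmoNorm f :=
      le_iSup_of_le c (le_iSup_of_le ρ (le_iSup_of_le hρ le_rfl))
    rwa [mul_comm, ← div_eq_mul_inv, ENNReal.div_le_iff hV0 hVtop] at h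
  have hmeas : Measurable fun x => ENNReal.ofReal |f x - ballAvg f c ρ| := by fun_prop
  have hcheb := (mul_meas_ge_le_lintegral (μ := volume.restrict (Metric.ball c ρ)) hmeas
    (ENNReal.ofReal t)).trans hosc
  have hset : {x | ENNReal.ofReal t ≤ ENNReal.ofReal |f x - ballAvg f c ρ|} =
      {x | t ≤ |f x - ballAvg f c ρ|} := by
    ext x
    simp [ENNReal.ofReal_le_ofReal_iff (abs_nonneg _)]
  rw [hset, Measure.restrict_apply (measurableSet_le (by fun_prop) (by fun_prop)),
    Set.inter_comm] at hcheb
  have h := ENNReal.toReal_mono (ENNReal.mul_ne_top hfin hVtop) hcheb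
  rwa [ENNReal.toReal_mul, ENNReal.toReal_mul, ENNReal.toReal_ofReal ht] at h

/-- If `|f| ≤ l` on at least half of a ball, then `|f|` rarely exceeds `l` by a large multiple of
the BMO seminorm in that ball. -/
lemma measureReal_ball_inter_superlevel_le {f : En n → ℝ} (hf : Measurable f)
    (hfin : bmoNorm f ≠ ∞) (hpos : 0 < (bmoNorm f).toReal) (c : En n) {ρ : ℝ} (hρ : 0 < ρ)
    {l K : ℝ} (hK : 0 < K)
    (hhalf : 2 * volume.real ({x | l < |f x|} ∩ Metric.ball c ρ) ≤
      volume.real (Metric.ball c ρ)) :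
    K * volume.real ({x | l + (2 + K) * (bmoNorm f).toReal < |f x|} ∩ Metric.ball c ρ) ≤
      volume.real (Metric.ball c ρ) := by
  set N := (bmoNorm f).toReal with hN
  set m := ballAvg f c ρ with hm
  have hVtop : volume (Metric.ball c ρ) ≠ ∞ := measure_ball_lt_top.ne
  have hV0 : 0 < volume.real (Metric.ball c ρ) :=
    ENNReal.toReal_pos (Metric.measure_ball_pos volume c hρ).ne' hVtop
  have hmean : |m| ≤ l + 2 * N := by
    by_contra! hlt
    have hcheb := mul_measureReal_oscillation_le hf hfin c hρ (t := |m| - l) (by linarith)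
    have hcover : Metric.ball c ρ ⊆ ({x | l < |f x|} ∩ Metric.ball c ρ) ∪
        (Metric.ball c ρ ∩ {x | |m| - l ≤ |f x - m|}) := by
      intro x hx
      by_cases hxl : l < |f x|
      · exact Or.inl ⟨hxl, hx⟩
      · refine Or.inr ⟨hx, ?_⟩
        have h1 := abs_sub_abs_le_abs_sub m (f x)
        rw [abs_sub_comm] at h1
        simp only [Set.mem_ofPred_eq]
        linarith
    have h1 := (measureReal_mono hcover (ne_top_of_le_ne_top hVtop
      (measure_mono (Set.union_subset Set.inter_subset_right Set.inter_subset_left)))).trans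
      (measureReal_union_le (μ := volume) _ _)
    rw [← hm, ← hN] at hcheb
    nlinarith
  have hcheb := mul_measureReal_oscillation_le hf hfin c hρ (t := K * N) (by positivity)
  have hsub : {x | l + (2 + K) * N < |f x|} ∩ Metric.ball c ρ ⊆
      Metric.ball c ρ ∩ {x | K * N ≤ |f x - m|} := by
    rintro x ⟨hx, hxB⟩
    refine ⟨hxB, ?_⟩
    have h1 := abs_sub_abs_le_abs_sub (f x) m
    simp only [Set.mem_ofPred_eq] at hx ⊢
    nlinarith
  have h1 : volume.real ({x | l + (2 + K) * N < |f x|} ∩ Metric.ball c ρ) ≤ _ :=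
    measureReal_mono hsub (ne_top_of_le_ne_top hVtop (measure_mono Set.inter_subset_left))
  rw [← hm, ← hN] at hcheb
  have h2 : N * (K * volume.real ({x | l + (2 + K) * N < |f x|} ∩ Metric.ball c ρ)) ≤
      N * volume.real (Metric.ball c ρ) := by
    calc _ = (K * N) * volume.real ({x | l + (2 + K) * N < |f x|} ∩ Metric.ball c ρ) := by ring
      _ ≤ _ := (mul_le_mul_of_nonneg_left h1 (by positivity)).trans hcheb
  exact le_of_mul_le_mul_left h2 hpos

/-- At almost every point of a set `E` of finite measure there is a ball more than half filled by
`E`, such that all substantially larger concentric balls are at most half filled. -/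
lemma ae_exists_radius_half_filled (hn : n ≠ 0) {E : Set (En n)} (hE : MeasurableSet E)
    (hEfin : volume E ≠ ∞) :
    ∃ R : ℝ, ∀ᵐ x, x ∈ E → ∃ r, 0 < r ∧ r ≤ R ∧
      volume.real (Metric.closedBall x r) ≤ 2 * volume.real (E ∩ Metric.closedBall x r) ∧
      ∀ s, 2 * r ≤ s →
        2 * volume.real (E ∩ Metric.closedBall x s) ≤ volume.real (Metric.closedBall x s) := by
  have hω : 0 < volume.real (Metric.ball (0 : En n) 1) :=
    ENNReal.toReal_pos (Metric.measure_ball_pos volume _ one_pos).ne' measure_ball_lt_top.ne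
  set ω := volume.real (Metric.ball (0 : En n) 1)
  set R := max 1 (2 * volume.real E / ω)
  refine ⟨R, ?_⟩
  have hbound : ∀ x : En n, ∀ r : ℝ, 0 < r →
      volume.real (Metric.closedBall x r) ≤ 2 * volume.real (E ∩ Metric.closedBall x r) →
      r ≤ R := by
    intro x r hr h
    by_contra! hlt
    have h1 : 1 < r := (le_max_left _ _).trans_lt hlt
    have h2 : 2 * volume.real E / ω < r := (le_max_right _ _).trans_lt hlt
    rw [div_lt_iff₀ hω] at h2
    have h3 : volume.real (Metric.closedBall x r) = r ^ n * ω := by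
      rw [measureReal_def, Measure.addHaar_closedBall _ _ hr.le, ENNReal.toReal_mul,
        ENNReal.toReal_ofReal (by positivity), finrank_euclideanSpace_fin]
      rfl
    have h4 : volume.real (E ∩ Metric.closedBall x r) ≤ volume.real E :=
      measureReal_mono Set.inter_subset_left hEfin
    have h5 : r ≤ r ^ n := le_self_pow₀ h1.le hn
    nlinarith
  filter_upwards [Besicovitch.ae_tendsto_measure_inter_div_of_measurableSet
    (volume : Measure (En n)) hE] with x hx hxE
  rw [Set.indicator_of_mem hxE] at hx
  set S := {r : ℝ | 0 < r ∧
    volume.real (Metric.closedBall x r) ≤ 2 * volume.real (E ∩ Metric.closedBall x r)}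
  have hSne : S.Nonempty := by
    have h1 : ∀ᶠ r in nhdsWithin (0 : ℝ) (Set.Ioi 0),
        (2 : ℝ≥0∞)⁻¹ < volume (E ∩ Metric.closedBall x r) / volume (Metric.closedBall x r) :=
      hx.eventually_const_lt (by simp)
    obtain ⟨r, hr, hr0⟩ := (h1.and self_mem_nhdsWithin).exists
    refine ⟨r, hr0, ?_⟩
    have hVtop : volume (Metric.closedBall x r) ≠ ∞ := measure_closedBall_lt_top.ne
    have hV0 : volume (Metric.closedBall x r) ≠ 0 :=
      (Metric.measure_closedBall_pos volume x hr0).ne'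
    have h2 := (ENNReal.le_div_iff_mul_le (Or.inl hV0) (Or.inl hVtop)).1 hr.le
    have h3 := ENNReal.toReal_mono (ne_top_of_le_ne_top hVtop
      (measure_mono Set.inter_subset_right)) h2
    rw [ENNReal.toReal_mul, ENNReal.toReal_inv, ENNReal.toReal_ofNat] at h3
    rw [measureReal_def, measureReal_def]
    linarith
  have hSbdd : BddAbove S := ⟨R, fun r hr => hbound x r hr.1 hr.2⟩
  obtain ⟨r₀, hr₀⟩ := hSne
  have hsup : 0 < sSup S := hr₀.1.trans_le (le_csSup hSbdd hr₀)
  obtain ⟨r, hrS, hr⟩ := exists_lt_of_lt_csSup ⟨r₀, hr₀⟩ (half_lt_self hsup)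
  refine ⟨r, hrS.1, hbound x r hrS.1 hrS.2, hrS.2, fun s hs => ?_⟩
  by_contra! hlt
  have h1 : s ∈ S := ⟨by linarith [hrS.1], hlt.le⟩
  linarith [le_csSup hSbdd h1]

/-- Raising the level by a fixed multiple of the BMO seminorm halves the distribution function. -/
lemma volume_superlevel_add_le_half (hn : n ≠ 0) {f : En n → ℝ} (hf : Measurable f)
    (hfin : bmoNorm f ≠ ∞) (hpos : 0 < (bmoNorm f).toReal) {l : ℝ}
    (hl : volume {x | l < |f x|} ≠ ∞) :
    volume {x | l + (2 + 4 * 6 ^ n) * (bmoNorm f).toReal < |f x|} ≤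
      2⁻¹ * volume {x | l < |f x|} := by
  set E := {x | l < |f x|} with hEdef
  set F := {x | l + (2 + 4 * 6 ^ n) * (bmoNorm f).toReal < |f x|} with hFdef
  have hE : MeasurableSet E := measurableSet_lt (by fun_prop) (by fun_prop)
  have hFE : F ⊆ E := by
    intro x hx
    have h1 : 0 ≤ (2 + 4 * 6 ^ n) * (bmoNorm f).toReal := by positivity
    simp only [hEdef, hFdef, Set.mem_ofPred_eq] at hx ⊢
    linarith
  obtain ⟨R, hR⟩ := ae_exists_radius_half_filled hn hE hl
  set G := {x | x ∈ E ∧ ∃ r, 0 < r ∧ r ≤ R ∧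
      volume.real (Metric.closedBall x r) ≤ 2 * volume.real (E ∩ Metric.closedBall x r) ∧
      ∀ s, 2 * r ≤ s →
        2 * volume.real (E ∩ Metric.closedBall x s) ≤ volume.real (Metric.closedBall x s)}
  have hr : ∀ x, ∃ r, x ∈ G → 0 < r ∧ r ≤ R ∧
      volume.real (Metric.closedBall x r) ≤ 2 * volume.real (E ∩ Metric.closedBall x r) ∧
      ∀ s, 2 * r ≤ s →
        2 * volume.real (E ∩ Metric.closedBall x s) ≤ volume.real (Metric.closedBall x s) := by
    intro x
    by_cases hx : x ∈ G
    · obtain ⟨r, h⟩ := hx.2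
      exact ⟨r, fun _ => h⟩
    · exact ⟨0, fun h => absurd h hx⟩
  choose r hr using hr
  obtain ⟨u, huG, hdisj, hcov⟩ := Vitali.exists_disjoint_subfamily_covering_enlargement_closedBall
    G id r R (fun x hx => (hr x hx).2.1) 5 (by norm_num)
  simp only [id] at hdisj hcov
  have hucount : u.Countable := hdisj.countable_of_nonempty_interior fun x hx =>
    ⟨x, Metric.ball_subset_interior_closedBall (Metric.mem_ball_self (hr x (huG hx)).1)⟩
  have hball : ∀ x ∈ u, volume (F ∩ Metric.ball x (6 * r x)) ≤
      2⁻¹ * volume (E ∩ Metric.closedBall x (r x)) := by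
    intro x hx
    obtain ⟨h0, -, hbig, hsmall⟩ := hr x (huG hx)
    have hreal : ∀ s, 0 < s → volume.real (Metric.closedBall x s) =
        volume.real (Metric.ball x s) := fun s hs => by
      rw [measureReal_def, measureReal_def, Measure.addHaar_closedBall _ _ hs.le,
        Measure.addHaar_ball_of_pos _ _ hs]
    have hscale : volume.real (Metric.ball x (6 * r x)) =
        6 ^ n * volume.real (Metric.ball x (r x)) := by
      rw [measureReal_def, measureReal_def, Measure.addHaar_ball_mul_of_pos _ _ (by norm_num),
        ENNReal.toReal_mul, ENNReal.toReal_ofReal (by positivity), finrank_euclideanSpace_fin,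
        Measure.addHaar_ball_center volume x]
    have hhalf : 2 * volume.real (E ∩ Metric.ball x (6 * r x)) ≤
        volume.real (Metric.ball x (6 * r x)) := by
      have h1 := hsmall (6 * r x) (by linarith)
      rw [hreal _ (by positivity)] at h1
      have h2 : volume.real (E ∩ Metric.ball x (6 * r x)) ≤
          volume.real (E ∩ Metric.closedBall x (6 * r x)) :=
        measureReal_mono (Set.inter_subset_inter_right _ Metric.ball_subset_closedBall)
          (ne_top_of_le_ne_top hl (measure_mono Set.inter_subset_left))
      linarith
    have hK := measureReal_ball_inter_superlevel_le hf hfin hpos x (by positivity)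
      (K := 4 * 6 ^ n) (by positivity) hhalf
    rw [hscale, ← hreal _ h0] at hK
    have hfinal : volume.real (F ∩ Metric.ball x (6 * r x)) ≤
        2⁻¹ * volume.real (E ∩ Metric.closedBall x (r x)) := by
      have h6 : (0 : ℝ) < 6 ^ n := by positivity
      have h3 : (6 ^ n : ℝ) * (4 * volume.real (F ∩ Metric.ball x (6 * r x))) ≤
          6 ^ n * volume.real (Metric.closedBall x (r x)) := by
        calc _ = 4 * 6 ^ n * volume.real (F ∩ Metric.ball x (6 * r x)) := by ring
          _ ≤ _ := hK
      have h4 := le_of_mul_le_mul_left h3 h6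
      linarith
    have hEtop : volume (E ∩ Metric.closedBall x (r x)) ≠ ∞ :=
      ne_top_of_le_ne_top hl (measure_mono Set.inter_subset_left)
    have hFtop : volume (F ∩ Metric.ball x (6 * r x)) ≠ ∞ :=
      ne_top_of_le_ne_top measure_ball_lt_top.ne (measure_mono Set.inter_subset_right)
    rw [← ENNReal.toReal_le_toReal hFtop (ENNReal.mul_ne_top (by simp) hEtop),
      ENNReal.toReal_mul, ENNReal.toReal_inv, ENNReal.toReal_ofNat]
    exact hfinal
  have hcover : F ≤ᵐ[volume] ⋃ x ∈ u, F ∩ Metric.ball x (6 * r x) := by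
    filter_upwards [hR] with x hx hxF
    have hxG : x ∈ G := ⟨hFE hxF, hx (hFE hxF)⟩
    obtain ⟨y, hyu, hy⟩ := hcov x hxG
    have hxy := hy (Metric.mem_closedBall_self (hr x hxG).1.le)
    refine Set.mem_biUnion hyu ⟨hxF, ?_⟩
    rw [Metric.mem_closedBall] at hxy
    rw [Metric.mem_ball]
    linarith [(hr y (huG hyu)).1]
  have := hucount.to_subtype
  calc volume F ≤ volume (⋃ x ∈ u, F ∩ Metric.ball x (6 * r x)) := measure_mono_ae hcover
    _ ≤ ∑' x : u, volume (F ∩ Metric.ball (x : En n) (6 * r x)) := measure_biUnion_le _ hucount _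
    _ ≤ ∑' x : u, 2⁻¹ * volume (E ∩ Metric.closedBall (x : En n) (r x)) :=
        ENNReal.tsum_le_tsum fun x => hball x x.2
    _ = 2⁻¹ * volume (⋃ x ∈ u, E ∩ Metric.closedBall x (r x)) := by
        rw [ENNReal.tsum_mul_left, measure_biUnion hucount
          (hdisj.mono fun x => Set.inter_subset_right)
          fun x _ => hE.inter Metric.isClosed_closedBall.measurableSet]
    _ ≤ 2⁻¹ * volume E := by
        gcongr
        exact Set.iUnion₂_subset fun x _ => Set.inter_subset_left

lemma bmoNorm_eq_zero_of_dim_zero (f : En 0 → ℝ) : bmoNorm f = 0 := by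
  simp only [bmoNorm, ENNReal.iSup_eq_zero, mul_eq_zero]
  intro c ρ hρ
  right
  have havg : ballAvg f c ρ = f c := by
    have hconst : f = fun _ => f c := funext fun x => congrArg f (Subsingleton.elim x c)
    rw [ballAvg, hconst]
    exact setAverage_const (Metric.measure_ball_pos volume c hρ).ne' measure_ball_lt_top.ne _
  have h : ∀ x, ENNReal.ofReal |f x - ballAvg f c ρ| = 0 := fun x => by
    rw [havg, Subsingleton.elim x c]
    simp
  simp [h]

theorem stmt15 (n : ℕ) :
    ∃ α > (0 : ℝ), ∃ C > (0 : ℝ), ∀ f : En n → ℝ,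
      Measurable f → Integrable f volume → LocallyIntegrable f volume →
      bmoNorm f ≠ ∞ → bmoNorm f ≠ 0 →
      ∀ l : ℝ, (bmoNorm f).toReal < l →
        volume {x | l < |f x|} ≤
          ENNReal.ofReal C * ((∫⁻ x, ENNReal.ofReal |f x|) / bmoNorm f) *
            ENNReal.ofReal (Real.exp (-(α * l) / (bmoNorm f).toReal)) := by
  rcases eq_or_ne n 0 with rfl | hn
  · exact ⟨1, one_pos, 1, one_pos, fun f _ _ _ _ h0 =>
      absurd (bmoNorm_eq_zero_of_dim_zero f) h0⟩
  have hA : (0 : ℝ) < 2 + 4 * 6 ^ n := by positivity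
  set A : ℝ := 2 + 4 * 6 ^ n with hAdef
  have hα : 0 < Real.log 2 / A := div_pos (Real.log_pos one_lt_two) hA
  set α := Real.log 2 / A with hαdef
  refine ⟨α, hα, Real.exp (α * (1 + A)), Real.exp_pos _, ?_⟩
  intro f hf hint _ hfin h0 l hl
  have hpos : 0 < (bmoNorm f).toReal := ENNReal.toReal_pos h0 hfin
  set N := (bmoNorm f).toReal with hN
  have hI : ∫⁻ x, ENNReal.ofReal |f x| ≠ ∞ := by
    simpa only [HasFiniteIntegral, Real.enorm_eq_ofReal_abs] using hint.2.ne
  have hbase : volume {x | N < |f x|} ≤ (∫⁻ x, ENNReal.ofReal |f x|) / bmoNorm f := by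
    refine (measure_mono fun x hx => ?_).trans (meas_ge_le_lintegral_div
      (f := fun x => ENNReal.ofReal |f x|) (by fun_prop) h0 hfin)
    simp only [Set.mem_ofPred_eq] at hx ⊢
    rw [← ENNReal.ofReal_toReal hfin]
    exact ENNReal.ofReal_le_ofReal hx.le
  have hQ : (∫⁻ x, ENNReal.ofReal |f x|) / bmoNorm f ≠ ∞ := ENNReal.div_ne_top hI h0
  set Q := (∫⁻ x, ENNReal.ofReal |f x|) / bmoNorm f
  have hiter : ∀ k : ℕ, volume {x | N + k * (A * N) < |f x|} ≤ (2⁻¹) ^ k * Q := by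
    intro k
    induction k with
    | zero => simpa using hbase
    | succ k ih =>
      have h1 := volume_superlevel_add_le_half hn hf hfin hpos
        (ne_top_of_le_ne_top (ENNReal.mul_ne_top (by simp) hQ) ih)
      have h2 : N + ((k + 1 : ℕ) : ℝ) * (A * N) = N + k * (A * N) + A * N := by
        push_cast; ring
      rw [h2, pow_succ', mul_assoc]
      exact h1.trans (by gcongr)
  have hk0 : 0 ≤ (l - N) / (A * N) := div_nonneg (by linarith) (by positivity)
  set k := ⌊(l - N) / (A * N)⌋₊
  have hk1 : N + k * (A * N) ≤ l := by
    have h1 := Nat.floor_le hk0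
    rw [le_div_iff₀ (by positivity)] at h1
    linarith
  have hk2 : l / N ≤ 1 + A + A * k := by
    have h1 := (Nat.lt_floor_add_one ((l - N) / (A * N))).le
    rw [div_le_iff₀ (by positivity)] at h1
    rw [div_le_iff₀ hpos]
    calc l ≤ (k + 1) * (A * N) + N := by linarith
      _ = _ := by ring
  have hpow : ((2 : ℝ≥0∞)⁻¹) ^ k ≤ ENNReal.ofReal (Real.exp (α * (1 + A))) *
      ENNReal.ofReal (Real.exp (-(α * l) / N)) := by
    have h1 : ((2 : ℝ≥0∞)⁻¹) ^ k = ENNReal.ofReal (Real.exp (-(k * Real.log 2))) := by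
      rw [Real.exp_neg, Real.exp_nat_mul, Real.exp_log two_pos, ← inv_pow,
        ENNReal.ofReal_pow (by norm_num), ENNReal.ofReal_inv_of_pos two_pos, ENNReal.ofReal_ofNat]
    rw [h1, ← ENNReal.ofReal_mul (Real.exp_pos _).le, ← Real.exp_add]
    refine ENNReal.ofReal_le_ofReal (Real.exp_le_exp.2 ?_)
    have h2 : α * A = Real.log 2 := div_mul_cancel₀ _ hA.ne'
    have h3 := mul_le_mul_of_nonneg_left hk2 hα.le
    have h4 : -(α * l) / N = -(α * (l / N)) := by ring
    rw [h4, ← h2]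
    linarith
  calc volume {x | l < |f x|} ≤ volume {x | N + k * (A * N) < |f x|} :=
        measure_mono fun x hx => hk1.trans_lt hx
    _ ≤ (2⁻¹) ^ k * Q := hiter k
    _ ≤ _ := by
        rw [mul_right_comm]
        gcongr
end
end
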